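/- Let μ ∈ ℝ, σ > 0, y⋆ ∈ ℝ, and set γ = (y⋆ − μ)/σ. Let p : ℝ → ℝ be the density of the normal distribution N(μ, σ²) truncated above at y⋆, i.e., p(y) = ψ((y − μ)/σ)/(σ·Ψ(γ)) for y < y⋆ and p(y) = 0 for y ≥ y⋆. Then the differential entropy of p satisfies −∫ p(y)·log p(y) dy = log(√(2πe)·σ·Ψ(γ)) − γ·ψ(γ)/(2Ψ(γ)). -/

import Mathlib

open Real MeasureTheory

/-- The standard normal probability density function. -/
noncomputable def normalPdf (u : ℝ) : ℝ := (Real.sqrt (2 * Real.pi))⁻¹ * Real.exp (-u ^ 2 / 2)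

/-- The standard normal cumulative distribution function. -/
noncomputable def normalCdf (u : ℝ) : ℝ := ∫ t in Set.Iic u, normalPdf t

lemma aux_int0 : Integrable normalPdf := by
  have h := (integrable_exp_neg_mul_sq (b := 1/2) (by norm_num)).const_mul (Real.sqrt (2 * Real.pi))⁻¹
  refine h.congr (Filter.Eventually.of_forall fun x => ?_)
  simp only [normalPdf]; congr 2; ring

lemma aux_int1 : Integrable (fun u => u * normalPdf u) := by
  have h := (integrable_mul_exp_neg_mul_sq (b := 1/2) (by norm_num)).const_mul (Real.sqrt (2 * Real.pi))⁻¹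
  refine h.congr (Filter.Eventually.of_forall fun x => ?_)
  simp only [normalPdf]
  rw [show -(1/2) * x ^ 2 = -x^2/2 by ring]; ring

lemma aux_int2 : Integrable (fun u => u ^ 2 * normalPdf u) := by
  have h := (integrable_rpow_mul_exp_neg_mul_sq (b := 1/2) (by norm_num)
    (s := (2 : ℕ)) (by norm_num)).const_mul (Real.sqrt (2 * Real.pi))⁻¹
  refine h.congr (Filter.Eventually.of_forall fun x => ?_)
  simp only [normalPdf, Real.rpow_natCast]
  rw [show -(1/2) * x ^ 2 = -x^2/2 by ring]; ring

lemma aux_pos (u : ℝ) : 0 < normalPdf u := by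
  unfold normalPdf; positivity

lemma aux_cdf_pos (u : ℝ) : 0 < normalCdf u := by
  unfold normalCdf
  rw [setIntegral_pos_iff_support_of_nonneg_ae
    (Filter.Eventually.of_forall fun x => (aux_pos x).le) aux_int0.integrableOn]
  have : Function.support normalPdf = Set.univ := by
    ext x; simp [(aux_pos x).ne']
  rw [this]; simp

lemma aux_deriv (x : ℝ) : HasDerivAt (fun u => u * normalPdf u)
    (normalPdf x - x ^ 2 * normalPdf x) x := by
  have h1 : HasDerivAt (fun u : ℝ => -u ^ 2 / 2) (-x) x := by
    have := ((hasDerivAt_pow 2 x).neg).div_const 2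
    exact this.congr_deriv (by simp; ring)
  have h2 : HasDerivAt normalPdf ((Real.sqrt (2 * Real.pi))⁻¹ * (Real.exp (-x ^ 2 / 2) * (-x))) x :=
    h1.exp.const_mul _
  have h3 := (hasDerivAt_id x).mul h2
  refine h3.congr_deriv ?_
  simp only [normalPdf, id]; ring

lemma aux_second (γ : ℝ) : ∫ u in Set.Iic γ, u ^ 2 * normalPdf u =
    normalCdf γ - γ * normalPdf γ := by
  have hi : Integrable (fun x => normalPdf x - x ^ 2 * normalPdf x) := aux_int0.sub aux_int2
  have ht := tendsto_zero_of_hasDerivAt_of_integrableOn_Iic (a := γ)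
    (fun x _ => aux_deriv x) hi.integrableOn aux_int1.integrableOn
  have h := integral_Iic_of_hasDerivAt_of_tendsto' (a := γ)
    (fun x _ => aux_deriv x) hi.integrableOn ht
  rw [integral_sub aux_int0.integrableOn aux_int2.integrableOn] at h
  unfold normalCdf
  linarith

/-- Differential entropy of the upper-truncated Gaussian: if `p` is the density of
`N(μ, σ²)` truncated above at `y⋆` and `γ = (y⋆ − μ)/σ`, then
`−∫ p log p = log(√(2πe)·σ·Ψ(γ)) − γψ(γ)/(2Ψ(γ))`. -/
theorem truncated_gaussian_entropy
    (μ σ ystar : ℝ) (hσ : 0 < σ)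
    (γ : ℝ) (hγ : γ = (ystar - μ) / σ)
    (p : ℝ → ℝ)
    (hp : ∀ y : ℝ,
      p y = if y < ystar then normalPdf ((y - μ) / σ) / (σ * normalCdf γ) else 0) :
    -∫ y : ℝ, p y * Real.log (p y)
      = Real.log (Real.sqrt (2 * Real.pi * Real.exp 1) * σ * normalCdf γ)
        - γ * normalPdf γ / (2 * normalCdf γ) := by
  have hZ := aux_cdf_pos γ
  set Z := normalCdf γ with hZdef
  have h2pi : 0 < Real.sqrt (2 * Real.pi) := by positivity
  set L := Real.log (Real.sqrt (2 * Real.pi) * σ * Z) with hL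
  have key : ∀ u : ℝ, p (σ * u + μ) * Real.log (p (σ * u + μ)) =
      (Set.Iio γ).indicator (fun u => (-(1 / (2 * (σ * Z)))) * (u ^ 2 * normalPdf u)
        + (-(L / (σ * Z))) * normalPdf u) u := by
    intro u
    have hiff : σ * u + μ < ystar ↔ u < γ := by
      rw [hγ, lt_div_iff₀ hσ]; constructor <;> intro h <;> linarith
    rw [hp]
    by_cases hu : u < γ
    · rw [if_pos (hiff.2 hu), Set.indicator_of_mem (by exact hu)]
      have e : (σ * u + μ - μ) / σ = u := by field_simp; ring
      rw [e]
      have hlog : Real.log (normalPdf u / (σ * Z)) = -u ^ 2 / 2 - L := by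
        rw [show normalPdf u / (σ * Z) = Real.exp (-u ^ 2 / 2) / (Real.sqrt (2 * Real.pi) * σ * Z) by
          unfold normalPdf; field_simp]
        rw [Real.log_div (by positivity) (by positivity), Real.log_exp]
      rw [hlog]
      field_simp
      ring
    · rw [if_neg (fun h => hu (hiff.1 h)), Set.indicator_of_notMem (by exact hu)]
      simp
  have hcv : ∫ y : ℝ, p y * Real.log (p y) =
      σ * ∫ u : ℝ, p (σ * u + μ) * Real.log (p (σ * u + μ)) := by
    have h1 := Measure.integral_comp_mul_left (fun y => p (y + μ) * Real.log (p (y + μ))) σ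
    have h2 := integral_add_right_eq_self (μ := volume) (fun y => p y * Real.log (p y)) μ
    rw [h1, h2, abs_of_pos (inv_pos.2 hσ), smul_eq_mul]
    field_simp
  have hlogL : Real.log (Real.sqrt (2 * Real.pi * Real.exp 1) * σ * Z) = L + 1 / 2 := by
    rw [Real.sqrt_mul (by positivity), show Real.sqrt (2 * Real.pi) * Real.sqrt (Real.exp 1) * σ * Z
      = (Real.sqrt (2 * Real.pi) * σ * Z) * Real.sqrt (Real.exp 1) by ring,
      Real.log_mul (by positivity) (by positivity), Real.log_sqrt (by positivity), Real.log_exp]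
  rw [hcv, integral_congr_ae (Filter.Eventually.of_forall key), integral_indicator measurableSet_Iio,
    ← integral_Iic_eq_integral_Iio,
    integral_add (aux_int2.integrableOn.const_mul _) (aux_int0.integrableOn.const_mul _),
    integral_const_mul, integral_const_mul, aux_second, hlogL]
  change -(σ * (_ + _ * normalCdf γ)) = _
  rw [← hZdef]
  field_simp
  ring
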